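/- Let G and H be connected graphs, let M be a nonempty proper module of G, and let G' be the graph obtained from G by replacing G[M] with H. If |M| = |V(H)|, the minimum vertex covers of G[M] and of H have the same size, and the minimum connected vertex covers of G[M] and of H have the same size, then the size of a minimum connected vertex cover of G' is at most the size of a minimum connected vertex cover of G. -/

import Mathlib

open SimpleGraph Set

/-- `M` is a module of `G`: every vertex outside `M` is adjacent to all of `M`
or to none of `M`. -/
def SimpleGraph.IsModuleSet {V : Type*} (G : SimpleGraph V) (M : Set V) : Prop :=
  ∀ v ∉ M, (∀ m ∈ M, G.Adj v m) ∨ (∀ m ∈ M, ¬ G.Adj v m)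

/-- The graph obtained from `G` by replacing `G[M]` with `H`: its vertices are
`(V ∖ M) ⊕ V(H)`, with the edges of `G` outside `M`, the edges of `H`, and all
edges between `N_G(M) ∖ M` and `V(H)`. -/
def modularReplacement {V W : Type*} (G : SimpleGraph V) (M : Set V)
    (H : SimpleGraph W) : SimpleGraph ({v : V // v ∉ M} ⊕ W) :=
  SimpleGraph.fromRel (fun x y =>
    match x, y with
    | Sum.inl u, Sum.inl v => G.Adj u.1 v.1
    | Sum.inl u, Sum.inr _ => ∃ m ∈ M, G.Adj u.1 m
    | Sum.inr _, Sum.inl _ => False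
    | Sum.inr u, Sum.inr v => H.Adj u v)

section Invariants

variable {V : Type*} (G : SimpleGraph V)

/-- A dominating set. -/
def IsDomSet (D : Set V) : Prop := ∀ v ∉ D, ∃ u ∈ D, G.Adj v u

/-- A minimum dominating set. -/
def IsMinDomSet (D : Set V) : Prop :=
  IsDomSet G D ∧ ∀ D', IsDomSet G D' → D.ncard ≤ D'.ncard

/-- The domination number. -/
noncomputable def domNum : ℕ := sInf {n | ∃ D, IsDomSet G D ∧ D.ncard = n}

/-- A vertex cover. -/
def IsVCover (C : Set V) : Prop := ∀ ⦃u v⦄, G.Adj u v → u ∈ C ∨ v ∈ C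

/-- A minimum vertex cover. -/
def IsMinVCover (C : Set V) : Prop :=
  IsVCover G C ∧ ∀ C', IsVCover G C' → C.ncard ≤ C'.ncard

/-- The vertex cover number. -/
noncomputable def vcNum : ℕ := sInf {n | ∃ C, IsVCover G C ∧ C.ncard = n}

/-- A connected vertex cover. -/
def IsCVCover (C : Set V) : Prop := IsVCover G C ∧ (G.induce C).Connected

/-- A minimum connected vertex cover. -/
def IsMinCVCover (C : Set V) : Prop :=
  IsCVCover G C ∧ ∀ C', IsCVCover G C' → C.ncard ≤ C'.ncard

/-- The connected vertex cover number. -/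
noncomputable def cvcNum : ℕ := sInf {n | ∃ C, IsCVCover G C ∧ C.ncard = n}

/-- A feedback vertex set: its removal leaves an acyclic graph. -/
def IsFVS (S : Set V) : Prop := (G.induce Sᶜ).IsAcyclic

/-- A minimum feedback vertex set. -/
def IsMinFVS (S : Set V) : Prop :=
  IsFVS G S ∧ ∀ S', IsFVS G S' → S.ncard ≤ S'.ncard

/-- The feedback vertex set number. -/
noncomputable def fvsNum : ℕ := sInf {n | ∃ S, IsFVS G S ∧ S.ncard = n}

/-- An odd cycle transversal: its removal leaves a bipartite graph. -/
def IsOCT (S : Set V) : Prop := (G.induce Sᶜ).Colorable 2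

/-- A minimum odd cycle transversal. -/
def IsMinOCT (S : Set V) : Prop :=
  IsOCT G S ∧ ∀ S', IsOCT G S' → S.ncard ≤ S'.ncard

/-- The odd cycle transversal number. -/
noncomputable def octNum : ℕ := sInf {n | ∃ S, IsOCT G S ∧ S.ncard = n}

/-- An independent set: pairwise non-adjacent vertices. -/
def IsIndepSet' (I : Set V) : Prop := I.Pairwise (fun u v => ¬ G.Adj u v)

/-- A partition of `G` into `k` (vertex-disjoint) paths covering all vertices. -/
def IsPathPartition (k : ℕ) (P : Fin k → (u : V) × (v : V) × G.Walk u v) : Prop :=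
  (∀ i, (P i).2.2.IsPath) ∧
  (∀ i j, i ≠ j → ∀ x, x ∈ (P i).2.2.support → x ∉ (P j).2.2.support) ∧
  (∀ x : V, ∃ i, x ∈ (P i).2.2.support)

/-- The minimum number of paths in a partition of `G` into paths. -/
noncomputable def pathPartitionNum : ℕ :=
  sInf {k | ∃ P : Fin k → (u : V) × (v : V) × G.Walk u v, IsPathPartition G k P}

/-- `G` has a Hamiltonian cycle. -/
def HasHamCycle : Prop := ∃ (v : V) (p : G.Walk v v), p.IsCycle ∧ ∀ u : V, u ∈ p.support

/-- The number of vertices of a longest induced path of `G`. -/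
noncomputable def lipNum : ℕ :=
  sSup {n | ∃ S : Set V, Nonempty (G.induce S ≃g pathGraph n)}

/-- `X` is an induced matching with `k` edges: `X` has `2k` vertices and the
subgraph induced by `X` is `1`-regular. -/
def IsInducedMatching (X : Set V) (k : ℕ) : Prop :=
  X.ncard = 2 * k ∧ ∀ v ∈ X, ∃! u, u ∈ X ∧ G.Adj v u

/-- The maximum number of edges of an induced matching of `G`. -/
noncomputable def imNum : ℕ := sSup {k | ∃ X, IsInducedMatching G X k}

/-- An independent triangle packing with `k` triangles: pairwise disjoint
triangles with no edges of `G` between different triangles. -/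
def IsIndepTrianglePacking (k : ℕ) (f : Fin k → Set V) : Prop :=
  (∀ i, ∃ a b c : V, f i = {a, b, c} ∧ G.Adj a b ∧ G.Adj a c ∧ G.Adj b c) ∧
  (∀ i j, i ≠ j → ∀ u ∈ f i, ∀ v ∈ f j, u ≠ v ∧ ¬ G.Adj u v)

/-- The maximum number of triangles in an independent triangle packing of `G`. -/
noncomputable def itpNum : ℕ :=
  sSup {k | ∃ f : Fin k → Set V, IsIndepTrianglePacking G k f}

/-- `C` is the vertex set of an induced cycle of `G`. -/
def IsCycleSet (C : Set V) : Prop :=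
  3 ≤ C.ncard ∧ (G.induce C).Connected ∧ ∀ v ∈ C, {u | u ∈ C ∧ G.Adj v u}.ncard = 2

/-- An independent cycle packing with `k` cycles: pairwise disjoint induced
cycles with no edges of `G` between different cycles. -/
def IsIndepCyclePacking (k : ℕ) (f : Fin k → Set V) : Prop :=
  (∀ i, IsCycleSet G (f i)) ∧
  (∀ i j, i ≠ j → ∀ u ∈ f i, ∀ v ∈ f j, u ≠ v ∧ ¬ G.Adj u v)

/-- The maximum number of cycles in an independent cycle packing of `G`. -/
noncomputable def icpNum : ℕ :=
  sSup {k | ∃ f : Fin k → Set V, IsIndepCyclePacking G k f}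

end Invariants

section ModularReplacement

variable {V W : Type*} {G : SimpleGraph V} {H : SimpleGraph W} {M : Set V}

@[simp] theorem modularReplacement_adj_inl_inl (u v : {v : V // v ∉ M}) :
    (modularReplacement G M H).Adj (Sum.inl u) (Sum.inl v) ↔ G.Adj u.1 v.1 := by
  simp only [modularReplacement, SimpleGraph.fromRel_adj, ne_eq, Sum.inl.injEq]
  refine ⟨fun h => h.2.elim id fun h' => h'.symm, fun h => ⟨?_, Or.inl h⟩⟩
  rintro rfl
  exact h.ne rfl

@[simp] theorem modularReplacement_adj_inr_inr (u v : W) :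
    (modularReplacement G M H).Adj (Sum.inr u) (Sum.inr v) ↔ H.Adj u v := by
  simp only [modularReplacement, SimpleGraph.fromRel_adj, ne_eq, Sum.inr.injEq]
  exact ⟨fun h => h.2.elim id fun h' => h'.symm, fun h => ⟨h.ne, Or.inl h⟩⟩

@[simp] theorem modularReplacement_adj_inl_inr (u : {v : V // v ∉ M}) (w : W) :
    (modularReplacement G M H).Adj (Sum.inl u) (Sum.inr w) ↔ ∃ m ∈ M, G.Adj u.1 m := by
  simp [modularReplacement, SimpleGraph.fromRel_adj]

@[simp] theorem modularReplacement_adj_inr_inl (w : W) (u : {v : V // v ∉ M}) :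
    (modularReplacement G M H).Adj (Sum.inr w) (Sum.inl u) ↔ ∃ m ∈ M, G.Adj u.1 m := by
  rw [SimpleGraph.adj_comm, modularReplacement_adj_inl_inr]

/-- Connectedness transfers along a map that sends edges to reachable pairs and whose image
meets every component. -/
theorem SimpleGraph.Connected.of_reachable_map (hG : G.Connected) (f : V → W)
    (hadj : ∀ u v, G.Adj u v → H.Reachable (f u) (f v))
    (hsurj : ∀ w, ∃ v, H.Reachable (f v) w) : H.Connected := by
  have hmap : ∀ u v, H.Reachable (f u) (f v) := fun u v => by
    obtain ⟨p⟩ := hG.preconnected u v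
    induction p with
    | nil => exact .refl _
    | cons h _ ih => exact (hadj _ _ h).trans ih
  have := hG.nonempty.map f
  refine .mk fun a b => ?_
  obtain ⟨u, hu⟩ := hsurj a
  obtain ⟨v, hv⟩ := hsurj b
  exact hu.symm.trans ((hmap u v).trans hv)

/-- The trace of a vertex cover on a subset covers the induced subgraph. -/
theorem vcNum_induce_le {C : Set V} (hC : IsVCover G C) :
    vcNum (G.induce M) ≤ (C ∩ M).ncard := by
  refine Nat.sInf_le ⟨((↑) : M → V) ⁻¹' C, fun u v h => hC (u := u.1) (v := v.1) h, ?_⟩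
  rw [← Set.ncard_image_of_injective _ Subtype.val_injective, Subtype.image_preimage_coe,
    Set.inter_comm]

theorem exists_isVCover_ncard_eq_vcNum (G : SimpleGraph V) :
    ∃ C, IsVCover G C ∧ C.ncard = vcNum G :=
  Nat.sInf_mem (s := {n | ∃ C, IsVCover G C ∧ C.ncard = n})
    ⟨_, Set.univ, fun _ _ _ => Or.inl trivial, rfl⟩

theorem SimpleGraph.Connected.exists_isCVCover_ncard_eq_cvcNum (hG : G.Connected) :
    ∃ C, IsCVCover G C ∧ C.ncard = cvcNum G :=
  Nat.sInf_mem (s := {n | ∃ C, IsCVCover G C ∧ C.ncard = n})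
    ⟨_, Set.univ, ⟨fun _ _ _ => Or.inl trivial,
      (SimpleGraph.induceUnivIso G).connected_iff.2 hG⟩, rfl⟩

/-- A connected graph with vertex cover number zero has a single vertex. -/
theorem SimpleGraph.Connected.subsingleton_of_isVCover_empty (hG : G.Connected)
    (h : IsVCover G ∅) : Subsingleton V := by
  by_contra hns
  have := not_subsingleton_iff_nontrivial.1 hns
  obtain ⟨v⟩ := hG.nonempty
  obtain ⟨u, hu⟩ := hG.preconnected.exists_adj_of_nontrivial v
  simpa using h hu

theorem SimpleGraph.Connected.exists_adj_of_ne_univ (hG : G.Connected) (hne : M.Nonempty)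
    (hproper : M ≠ Set.univ) : ∃ v ∉ M, ∃ m ∈ M, G.Adj v m := by
  obtain ⟨m, hm⟩ := hne
  obtain ⟨v, hv⟩ := (Set.ne_univ_iff_exists_notMem M).1 hproper
  obtain ⟨p⟩ := hG.preconnected m v
  obtain ⟨d, -, h₁, h₂⟩ := p.exists_boundary_dart M hm hv
  exact ⟨d.snd, h₂, d.fst, h₁, d.adj.symm⟩

/-- The set obtained from `C` by replacing its part in `M` with `S`. -/
def replacedCover (M C : Set V) (S : Set W) : Set ({v : V // v ∉ M} ⊕ W) :=
  {x | Sum.elim (fun v => v.1 ∈ C) (· ∈ S) x}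

@[simp] theorem inl_mem_replacedCover {C : Set V} {S : Set W} (v : {v : V // v ∉ M}) :
    Sum.inl v ∈ replacedCover M C S ↔ v.1 ∈ C := Iff.rfl

@[simp] theorem inr_mem_replacedCover {C : Set V} {S : Set W} (w : W) :
    Sum.inr w ∈ replacedCover M C S ↔ w ∈ S := Iff.rfl

theorem ncard_replacedCover_le [Finite V] {C : Set V} {S : Set W}
    (hS : S.ncard ≤ (C ∩ M).ncard) : (replacedCover M C S).ncard ≤ C.ncard := by
  have heq : replacedCover M C S = Sum.inl '' {v : {v : V // v ∉ M} | v.1 ∈ C} ∪ Sum.inr '' S := by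
    ext (v | w) <;> simp
  have hdiff : {v : {v : V // v ∉ M} | v.1 ∈ C}.ncard = (C \ M).ncard := by
    rw [← Set.ncard_image_of_injective _ Subtype.val_injective]
    congr 1
    ext v
    simp [and_comm]
  calc (replacedCover M C S).ncard
      ≤ {v : {v : V // v ∉ M} | v.1 ∈ C}.ncard + S.ncard := by
        rw [heq]
        refine (Set.ncard_union_le _ _).trans_eq ?_
        rw [Set.ncard_image_of_injective _ Sum.inl_injective,
          Set.ncard_image_of_injective _ Sum.inr_injective]
    _ ≤ (C ∩ M).ncard + (C \ M).ncard := by omega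
    _ = C.ncard := Set.ncard_inter_add_ncard_sdiff_eq_ncard C M

theorem IsVCover.replacedCover {C : Set V} {S : Set W} (hC : IsVCover G C) (hS : IsVCover H S)
    (h : S = Set.univ ∨ ∀ v ∉ M, (∃ m ∈ M, G.Adj v m) → v ∈ C) :
    IsVCover (modularReplacement G M H) (replacedCover M C S) := by
  have key : ∀ (v : {v : V // v ∉ M}) (w : W), (∃ m ∈ M, G.Adj v.1 m) → v.1 ∈ C ∨ w ∈ S :=
    fun v w hv => h.elim (fun hS => .inr (hS ▸ trivial)) fun hN => .inl (hN v v.2 hv)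
  rintro (u | u) (v | v) huv <;> simp only [modularReplacement_adj_inl_inl,
    modularReplacement_adj_inl_inr, modularReplacement_adj_inr_inl,
    modularReplacement_adj_inr_inr] at huv
  · exact hC huv
  · exact key u v huv
  · exact (key v u huv).symm
  · exact hS huv

/-- A connected set that misses `M` stays connected after the replacement. -/
theorem connected_induce_replacedCover_empty {C : Set V} (hC : (G.induce C).Connected)
    (hM : ∀ v ∈ C, v ∉ M) :
    ((modularReplacement G M H).induce (replacedCover M C (∅ : Set W))).Connected := by
  refine hC.of_reachable_map (fun v => ⟨Sum.inl ⟨v.1, hM v.1 v.2⟩, v.2⟩) (fun u v huv => ?_) ?_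
  · refine SimpleGraph.Adj.reachable ?_
    simpa using huv
  · rintro ⟨v | w, hx⟩
    · exact ⟨⟨v.1, hx⟩, .refl _⟩
    · exact hx.elim

/-- Replacing a nonempty part of a connected set by a nonempty set `S` keeps it connected, if
the vertices of `S` are in one component afterwards. -/
theorem connected_induce_replacedCover {C : Set V} {S : Set W} (hC : (G.induce C).Connected)
    (hCM : (C ∩ M).Nonempty) (s₀ : S)
    (hS : ∀ s : S, ((modularReplacement G M H).induce (replacedCover M C S)).Reachable
      ⟨Sum.inr s₀.1, s₀.2⟩ ⟨Sum.inr s.1, s.2⟩) :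
    ((modularReplacement G M H).induce (replacedCover M C S)).Connected := by
  classical
  refine hC.of_reachable_map (fun v => if hv : v.1 ∈ M then ⟨Sum.inr s₀.1, s₀.2⟩
    else ⟨Sum.inl ⟨v.1, hv⟩, v.2⟩) (fun u v huv => ?_) ?_
  · have huv' : G.Adj u.1 v.1 := huv
    by_cases hu : u.1 ∈ M <;> by_cases hv : v.1 ∈ M <;> simp only [hu, hv, dite_true, dite_false]
    · exact .refl _
    · refine SimpleGraph.Adj.reachable ?_
      simpa using ⟨u.1, hu, huv'.symm⟩
    · refine SimpleGraph.Adj.reachable ?_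
      simpa using ⟨v.1, hv, huv'⟩
    · refine SimpleGraph.Adj.reachable ?_
      simpa using huv'
  · rintro ⟨v | w, hx⟩
    · refine ⟨⟨v.1, hx⟩, ?_⟩
      simp only [v.2, dite_false]
      exact .refl _
    · obtain ⟨m, hmC, hm⟩ := hCM
      refine ⟨⟨m, hmC⟩, ?_⟩
      simp only [hm, dite_true]
      exact hS ⟨w, hx⟩

end ModularReplacement

theorem stmt11 {V W : Type*} [Fintype V] [Fintype W]
    (G : SimpleGraph V) (H : SimpleGraph W) (M : Set V)
    (hG : G.Connected) (hH : H.Connected)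
    (hMod : G.IsModuleSet M) (hne : M.Nonempty) (hproper : M ≠ Set.univ)
    (hcard : M.ncard = Fintype.card W)
    (hvc : vcNum (G.induce M) = vcNum H)
    (hcvc : cvcNum (G.induce M) = cvcNum H) :
    cvcNum (modularReplacement G M H) ≤ cvcNum G := by
  suffices h : ∃ C, IsCVCover G C ∧ C.ncard = cvcNum G ∧ ∃ S : Set W,
      S.ncard ≤ (C ∩ M).ncard ∧
      IsCVCover (modularReplacement G M H) (replacedCover M C S) by
    obtain ⟨C, -, hCn, S, hS, hcov⟩ := h
    exact (show cvcNum _ ≤ _ from Nat.sInf_le ⟨_, hcov, rfl⟩).trans ((ncard_replacedCover_le hS).trans_eq hCn)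
  obtain ⟨C, ⟨hC, hCconn⟩, hCn⟩ := hG.exists_isCVCover_ncard_eq_cvcNum
  refine ⟨C, ⟨hC, hCconn⟩, hCn, ?_⟩
  by_cases hMC : M ⊆ C
  · have hCM : C ∩ M = M := Set.inter_eq_right.2 hMC
    obtain ⟨w₀⟩ := hH.nonempty
    refine ⟨Set.univ, by rw [hCM, hcard, Set.ncard_univ, Nat.card_eq_fintype_card],
      hC.replacedCover (fun _ _ _ => .inl trivial) (.inl rfl),
      connected_induce_replacedCover hCconn (hCM.symm ▸ hne) ⟨w₀, trivial⟩ fun s => ?_⟩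
    let f : H →g (modularReplacement G M H).induce (replacedCover M C Set.univ) :=
      { toFun := fun w => ⟨Sum.inr w, trivial⟩
        map_rel' := fun {a b} h => by simpa using h }
    exact (hH.preconnected w₀ s.1).map f
  · obtain ⟨m₀, hm₀, hm₀C⟩ := Set.not_subset.1 hMC
    have hN : ∀ v ∉ M, (∃ m ∈ M, G.Adj v m) → v ∈ C := by
      rintro v hv ⟨m, hm, hvm⟩
      have hall := (hMod v hv).resolve_right fun h => h m hm hvm
      exact (hC (hall m₀ hm₀)).resolve_right hm₀C
    obtain ⟨S, hS, hSn⟩ := exists_isVCover_ncard_eq_vcNum H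
    have hle : S.ncard ≤ (C ∩ M).ncard := by
      rw [hSn, ← hvc]
      exact vcNum_induce_le hC
    refine ⟨S, hle, hC.replacedCover hS (.inr hN), ?_⟩
    rcases S.eq_empty_or_nonempty with rfl | ⟨s₀, hs₀⟩
    · have := hH.subsingleton_of_isVCover_empty hS
      have hM1 : M.ncard ≤ 1 := hcard ▸ Fintype.card_le_one_iff_subsingleton.2 this
      refine connected_induce_replacedCover_empty hCconn fun v hvC hvM => hm₀C ?_
      rwa [(Set.ncard_le_one).1 hM1 m₀ hm₀ v hvM]
    · have hCM : (C ∩ M).Nonempty :=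
        Set.nonempty_of_ncard_ne_zero
          (((Set.ncard_pos (Set.toFinite S)).2 ⟨s₀, hs₀⟩).trans_le hle).ne'
      obtain ⟨n, hnM, hn⟩ := hG.exists_adj_of_ne_univ hne hproper
      let x : replacedCover M C S := ⟨Sum.inl ⟨n, hnM⟩, hN n hnM hn⟩
      have hx : ∀ s : S, ((modularReplacement G M H).induce (replacedCover M C S)).Reachable
          x ⟨Sum.inr s.1, s.2⟩ := fun s => SimpleGraph.Adj.reachable (by simpa [x] using hn)
      exact connected_induce_replacedCover hCconn hCM ⟨s₀, hs₀⟩ fun s =>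
        (hx ⟨s₀, hs₀⟩).symm.trans (hx s)
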